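/- arXiv:1504.06167 — 3 statements merged into one kernel-verified Lean document; each statement's English description precedes it below -/
import Mathlib

section
/- Let P ⊂ ℝ^d be a nonempty compact set and let A : P → ℝ^{n×n}, B : P → ℝ^{n×m} be continuous. If the discrete-time ensemble (A(θ), B(θ)) is uniformly ensemble controllable, then for every s ≥ m+1 and every choice of s pairwise distinct parameters θ_1, …, θ_s ∈ P, the intersection of the complex spectra σ(A(θ_1)) ∩ ⋯ ∩ σ(A(θ_s)) is empty. -/
open Matrix MeasureTheory

noncomputable section

/-- Solution of the discrete-time ensemble `x_{t+1} = A(θ) x_t + B(θ) u_t`, `x_0 = 0`,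
at time `T` under the parameter-independent input sequence `u`. -/
def discSol {d n m : ℕ} (A : (Fin d → ℝ) → Matrix (Fin n) (Fin n) ℝ)
    (B : (Fin d → ℝ) → Matrix (Fin n) (Fin m) ℝ)
    (T : ℕ) (u : ℕ → Fin m → ℝ) (θ : Fin d → ℝ) : Fin n → ℝ :=
  ∑ k ∈ Finset.range T, (A θ ^ k) *ᵥ (B θ *ᵥ u (T - 1 - k))

/-- Uniform ensemble controllability of the discrete-time ensemble. -/
def discUEC {d n m : ℕ} (P : Set (Fin d → ℝ))
    (A : (Fin d → ℝ) → Matrix (Fin n) (Fin n) ℝ)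
    (B : (Fin d → ℝ) → Matrix (Fin n) (Fin m) ℝ) : Prop :=
  ∀ xs : (Fin d → ℝ) → Fin n → ℝ, ContinuousOn xs P → ∀ ε : ℝ, 0 < ε →
    ∃ (T : ℕ) (u : ℕ → Fin m → ℝ), ∀ θ ∈ P, ‖discSol A B T u θ - xs θ‖ < ε

/-- The set of complex eigenvalues of a real square matrix. -/
def spec {n : ℕ} (M : Matrix (Fin n) (Fin n) ℝ) : Set ℂ :=
  spectrum ℂ (M.map (algebraMap ℝ ℂ))

/-- Every eigenvalue of a square matrix over a field has a left eigenvector. -/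
lemma exists_vecMul_eq_smul_of_mem_spectrum {ι K : Type*} [Fintype ι] [DecidableEq ι] [Field K]
    {M : Matrix ι ι K} {z : K} (hz : z ∈ spectrum K M) :
    ∃ w : ι → K, w ≠ 0 ∧ w ᵥ* M = z • w := by
  rw [spectrum.mem_iff, Matrix.isUnit_iff_isUnit_det, isUnit_iff_ne_zero, not_not] at hz
  obtain ⟨w, hw, hw0⟩ := Matrix.exists_vecMul_eq_zero_iff.mpr hz
  refine ⟨w, hw, ?_⟩
  rw [Matrix.vecMul_sub, sub_eq_zero, Algebra.algebraMap_eq_smul_one, Matrix.vecMul_smul,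
    Matrix.vecMul_one] at hw0
  exact hw0.symm

/-- A left eigenvector of a matrix is a left eigenvector of its powers. -/
lemma vecMul_pow_eq_smul {ι K : Type*} [Fintype ι] [DecidableEq ι] [CommRing K]
    {M : Matrix ι ι K} {z : K} {w : ι → K} (hw : w ᵥ* M = z • w) (k : ℕ) :
    w ᵥ* M ^ k = z ^ k • w := by
  induction k with
  | zero => simp
  | succ k ih => rw [pow_succ, ← Matrix.vecMul_vecMul, ih, Matrix.smul_vecMul, hw, smul_smul,
      pow_succ]

/-- Pairing the solution with a left eigenvector of `A θ` for the eigenvalue `z` depends on the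
input only through a vector determined by `z`. -/
lemma dotProduct_discSol {d n m : ℕ} (A : (Fin d → ℝ) → Matrix (Fin n) (Fin n) ℝ)
    (B : (Fin d → ℝ) → Matrix (Fin n) (Fin m) ℝ) (T : ℕ) (u : ℕ → Fin m → ℝ) (θ : Fin d → ℝ)
    {z : ℂ} {w : Fin n → ℂ} (hw : w ᵥ* (A θ).map (algebraMap ℝ ℂ) = z • w) :
    w ⬝ᵥ (algebraMap ℝ ℂ ∘ discSol A B T u θ) =
      (w ᵥ* (B θ).map (algebraMap ℝ ℂ)) ⬝ᵥ
        ∑ k ∈ Finset.range T, z ^ k • (algebraMap ℝ ℂ ∘ u (T - 1 - k)) := by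
  have hcast : algebraMap ℝ ℂ ∘ discSol A B T u θ = ∑ k ∈ Finset.range T,
      ((A θ).map (algebraMap ℝ ℂ)) ^ k *ᵥ
        ((B θ).map (algebraMap ℝ ℂ) *ᵥ (algebraMap ℝ ℂ ∘ u (T - 1 - k))) := by
    ext l
    simp only [discSol, Function.comp_apply, Finset.sum_apply, map_sum]
    refine Finset.sum_congr rfl fun k _ => ?_
    have hB : algebraMap ℝ ℂ ∘ (B θ *ᵥ u (T - 1 - k)) =
        (B θ).map (algebraMap ℝ ℂ) *ᵥ (algebraMap ℝ ℂ ∘ u (T - 1 - k)) :=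
      funext fun _ => RingHom.map_mulVec _ _ _ _
    rw [RingHom.map_mulVec, Matrix.map_pow, hB]
  rw [hcast, dotProduct_sum, dotProduct_sum]
  refine Finset.sum_congr rfl fun k _ => ?_
  rw [Matrix.dotProduct_mulVec, vecMul_pow_eq_smul hw, smul_dotProduct, dotProduct_smul,
    Matrix.dotProduct_mulVec]

/-- The pairing of a complex vector with a real vector is bounded by the sup norm. -/
lemma norm_dotProduct_algebraMap_comp_le {n : ℕ} (w : Fin n → ℂ) (x : Fin n → ℝ) :
    ‖w ⬝ᵥ (algebraMap ℝ ℂ ∘ x)‖ ≤ (∑ l, ‖w l‖) * ‖x‖ := by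
  rw [dotProduct, Finset.sum_mul]
  refine (norm_sum_le _ _).trans (Finset.sum_le_sum fun l _ => ?_)
  rw [norm_mul, Function.comp_apply, norm_algebraMap']
  exact mul_le_mul_of_nonneg_left (norm_le_pi_norm x l) (norm_nonneg _)

/-- If the ensemble is uniformly ensemble controllable, no nontrivial linear functional of the
values at finitely many distinct parameters vanishes on all solutions. -/
lemma discUEC.eq_zero_of_sum_dotProduct_eq_zero {d n m s : ℕ} {P : Set (Fin d → ℝ)}
    {A : (Fin d → ℝ) → Matrix (Fin n) (Fin n) ℝ} {B : (Fin d → ℝ) → Matrix (Fin n) (Fin m) ℝ}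
    (h : discUEC P A B) {θs : Fin s → Fin d → ℝ} (hθ : ∀ i, θs i ∈ P)
    (hinj : Function.Injective θs) {v : Fin s → Fin n → ℂ}
    (hv : ∀ T u, ∑ i, v i ⬝ᵥ (algebraMap ℝ ℂ ∘ discSol A B T u (θs i)) = 0) : v = 0 := by
  by_contra hne
  obtain ⟨j, hj⟩ := Function.ne_iff.mp hne
  obtain ⟨l, hl⟩ := Function.ne_iff.mp hj
  simp only [Pi.zero_apply] at hl
  set g : (Fin d → ℝ) → ℝ := fun θ => ∏ i ∈ Finset.univ.erase j, dist θ (θs i) with hg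
  have hgj : g (θs j) ≠ 0 := Finset.prod_ne_zero_iff.mpr fun i hi =>
    dist_ne_zero.mpr fun he => (Finset.mem_erase.mp hi).1 (hinj he).symm
  have hgi : ∀ i, i ≠ j → g (θs i) = 0 := fun i hi =>
    Finset.prod_eq_zero (Finset.mem_erase.mpr ⟨hi, Finset.mem_univ i⟩) (dist_self _)
  have hgc : Continuous g := by fun_prop
  set xs : (Fin d → ℝ) → Fin n → ℝ := fun θ => g θ • Pi.single l 1 with hxs
  have hxc : Continuous xs := by fun_prop
  have hval : ∑ i, v i ⬝ᵥ (algebraMap ℝ ℂ ∘ xs (θs i)) = v j l * (g (θs j) : ℂ) := by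
    rw [Finset.sum_eq_single j]
    · rw [dotProduct, Finset.sum_eq_single l]
      · simp [hxs]
      · intro b _ hb
        simp [hxs, hb]
      · simp
    · intro i _ hi
      simp [hxs, hgi i hi, dotProduct]
    · simp
  have hpos : 0 < ‖v j l * (g (θs j) : ℂ)‖ :=
    norm_pos_iff.mpr (mul_ne_zero hl (Complex.ofReal_ne_zero.mpr hgj))
  set C : ℝ := ∑ i, ∑ k, ‖v i k‖ with hC
  have hC0 : 0 ≤ C := by positivity
  obtain ⟨T, u, hu⟩ := h xs hxc.continuousOn (‖v j l * (g (θs j) : ℂ)‖ / (C + 1)) (by positivity)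
  have hdiff : v j l * (g (θs j) : ℂ) =
      -∑ i, v i ⬝ᵥ (algebraMap ℝ ℂ ∘ (discSol A B T u (θs i) - xs (θs i))) := by
    have hsub : ∀ i, algebraMap ℝ ℂ ∘ (discSol A B T u (θs i) - xs (θs i)) =
        algebraMap ℝ ℂ ∘ discSol A B T u (θs i) - algebraMap ℝ ℂ ∘ xs (θs i) := fun i => by
      ext k
      simp
    simp only [hsub, dotProduct_sub, Finset.sum_sub_distrib, hv T u, hval, zero_sub, neg_neg]
  have hle : ‖v j l * (g (θs j) : ℂ)‖ ≤ C * (‖v j l * (g (θs j) : ℂ)‖ / (C + 1)) := by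
    conv_lhs => rw [hdiff, norm_neg]
    rw [hC, Finset.sum_mul]
    refine (norm_sum_le _ _).trans (Finset.sum_le_sum fun i _ => ?_)
    exact (norm_dotProduct_algebraMap_comp_le _ _).trans
      (mul_le_mul_of_nonneg_left (hu _ (hθ i)).le (by positivity))
  rw [← mul_div_assoc, le_div_iff₀ (by positivity)] at hle
  linarith

/-- If the discrete-time ensemble is uniformly ensemble controllable, then for every
`s ≥ m + 1` and every choice of `s` pairwise distinct parameters in `P`, the
intersection of the spectra `σ(A(θ_1)) ∩ ⋯ ∩ σ(A(θ_s))` is empty. -/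
theorem discUEC_implies_spectra_intersection_empty {d n m : ℕ} (P : Set (Fin d → ℝ))
    (hPne : P.Nonempty) (hPc : IsCompact P)
    (A : (Fin d → ℝ) → Matrix (Fin n) (Fin n) ℝ)
    (B : (Fin d → ℝ) → Matrix (Fin n) (Fin m) ℝ)
    (hA : ContinuousOn A P) (hB : ContinuousOn B P)
    (h : discUEC P A B) :
    ∀ s : ℕ, m + 1 ≤ s → ∀ θs : Fin s → (Fin d → ℝ),
      (∀ i, θs i ∈ P) → Function.Injective θs →
      (⋂ i : Fin s, spec (A (θs i))) = ∅ := by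
  intro s hs θs hθ hinj
  refine Set.eq_empty_iff_forall_notMem.mpr fun z hz => ?_
  choose w hw0 hw using fun i =>
    exists_vecMul_eq_smul_of_mem_spectrum (Set.mem_iInter.mp hz i)
  have hdep : ¬ LinearIndependent ℂ fun i => w i ᵥ* (B (θs i)).map (algebraMap ℝ ℂ) := by
    intro hli
    have := hli.fintype_card_le_finrank
    simp only [Fintype.card_fin, Module.finrank_fin_fun] at this
    omega
  obtain ⟨c, hc, j, hj⟩ := Fintype.not_linearIndependent_iff.mp hdep
  have hzero : (fun i => c i • w i) = 0 := by
    refine h.eq_zero_of_sum_dotProduct_eq_zero hθ hinj fun T u => ?_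
    simp only [smul_dotProduct, dotProduct_discSol A B T u _ (hw _)]
    simp only [← smul_dotProduct]
    rw [← sum_dotProduct, hc, zero_dotProduct]
  exact smul_ne_zero hj (hw0 j) (congrFun hzero j)
end
end

section
/- Let P ⊂ ℝ^d be a nonempty compact set, let A : P → ℝ^{n×n}, B : P → ℝ^{n×m} be continuous, and let b_1(θ), …, b_m(θ) denote the columns of B(θ). The discrete-time ensemble (A(θ), B(θ)) is uniformly ensemble controllable if and only if the linear span of the set of continuous functions { θ ↦ A(θ)^k b_j(θ) : k ∈ ℕ_0, j = 1, …, m } is dense in the space C(P, ℝ^n) of continuous functions with the supremum norm. -/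
open Matrix MeasureTheory

noncomputable section

/-- The continuous function `θ ↦ A(θ)^k b_j(θ)` on `P`. -/
def columnMap {d n m : ℕ} {P : Set (Fin d → ℝ)}
    {A : (Fin d → ℝ) → Matrix (Fin n) (Fin n) ℝ}
    {B : (Fin d → ℝ) → Matrix (Fin n) (Fin m) ℝ}
    (hA : ContinuousOn A P) (hB : ContinuousOn B P) (k : ℕ) (j : Fin m) :
    C(P, Fin n → ℝ) where
  toFun θ := (A θ ^ k) *ᵥ fun i => B θ i j
  continuous_toFun := by
    have hA' : Continuous fun θ : P => A θ := hA.domRestrict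
    have hB' : Continuous fun θ : P => B θ := hB.domRestrict
    exact (hA'.pow k).matrix_mulVec (continuous_pi fun i => hB'.matrix_elem i j)

theorem pow_mulVec_mulVec_eq_sum {d n m : ℕ} (A : (Fin d → ℝ) → Matrix (Fin n) (Fin n) ℝ)
    (B : (Fin d → ℝ) → Matrix (Fin n) (Fin m) ℝ) (k : ℕ) (v : Fin m → ℝ) (θ : Fin d → ℝ) :
    (A θ ^ k) *ᵥ (B θ *ᵥ v) = ∑ j, v j • ((A θ ^ k) *ᵥ fun i => B θ i j) := by
  have h : B θ *ᵥ v = ∑ j, v j • fun i => B θ i j := by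
    ext i
    simp [Matrix.mulVec, dotProduct, mul_comm]
  rw [h, Matrix.mulVec_sum]
  simp only [Matrix.mulVec_smul]

/-- Solutions of the ensemble lie in the span of the functions `θ ↦ A(θ)^k b_j(θ)`. -/
theorem exists_mem_span_eq_discSol {d n m : ℕ} {P : Set (Fin d → ℝ)}
    {A : (Fin d → ℝ) → Matrix (Fin n) (Fin n) ℝ}
    {B : (Fin d → ℝ) → Matrix (Fin n) (Fin m) ℝ}
    (hA : ContinuousOn A P) (hB : ContinuousOn B P) (T : ℕ) (u : ℕ → Fin m → ℝ) :
    ∃ f ∈ Submodule.span ℝ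
        {f : C(P, Fin n → ℝ) | ∃ (k : ℕ) (j : Fin m),
          ∀ θ : P, f θ = (A θ ^ k) *ᵥ fun i => B θ i j},
      ∀ θ : P, f θ = discSol A B T u θ := by
  refine ⟨∑ k ∈ Finset.range T, ∑ j, u (T - 1 - k) j • columnMap hA hB k j, ?_, fun θ => ?_⟩
  · exact Submodule.sum_mem _ fun k _ => Submodule.sum_mem _ fun j _ =>
      Submodule.smul_mem _ _ (Submodule.subset_span ⟨k, j, fun _ => rfl⟩)
  · simp only [discSol, pow_mulVec_mulVec_eq_sum, ContinuousMap.sum_apply, ContinuousMap.smul_apply]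
    rfl

/-- Every element of the span of the functions `θ ↦ A(θ)^k b_j(θ)` is given by eventually
constant sums `∑_{k < T} A(θ)^k B(θ) v_k`. -/
theorem exists_eq_sum_of_mem_span {d n m : ℕ} {P : Set (Fin d → ℝ)}
    {A : (Fin d → ℝ) → Matrix (Fin n) (Fin n) ℝ}
    {B : (Fin d → ℝ) → Matrix (Fin n) (Fin m) ℝ} {f : C(P, Fin n → ℝ)}
    (hf : f ∈ Submodule.span ℝ
        {f : C(P, Fin n → ℝ) | ∃ (k : ℕ) (j : Fin m),
          ∀ θ : P, f θ = (A θ ^ k) *ᵥ fun i => B θ i j}) :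
    ∃ (v : ℕ → Fin m → ℝ) (T₀ : ℕ), ∀ T ≥ T₀, ∀ θ : P,
      f θ = ∑ k ∈ Finset.range T, (A θ ^ k) *ᵥ (B θ *ᵥ v k) := by
  induction hf using Submodule.span_induction with
  | mem f hf =>
    obtain ⟨k, j, hkj⟩ := hf
    refine ⟨Pi.single k (Pi.single j 1), k + 1, fun T hT θ => ?_⟩
    rw [hkj, Finset.sum_eq_single_of_mem k (Finset.mem_range.2 hT)]
    · rw [Pi.single_eq_same, Matrix.mulVec_single_one]
      rfl
    · intro l _ hl
      simp [Pi.single_eq_of_ne hl]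
  | zero => exact ⟨0, 0, fun T _ θ => by simp⟩
  | add f g _ _ hf hg =>
    obtain ⟨v, T₁, hv⟩ := hf
    obtain ⟨w, T₂, hw⟩ := hg
    refine ⟨v + w, max T₁ T₂, fun T hT θ => ?_⟩
    rw [ContinuousMap.add_apply, hv T (le_of_max_le_left hT), hw T (le_of_max_le_right hT)]
    simp only [Pi.add_apply, Matrix.mulVec_add, Finset.sum_add_distrib]
  | smul c f _ hf =>
    obtain ⟨v, T₁, hv⟩ := hf
    refine ⟨c • v, T₁, fun T hT θ => ?_⟩
    rw [ContinuousMap.smul_apply, hv T hT]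
    simp only [Pi.smul_apply, Matrix.mulVec_smul, Finset.smul_sum]

theorem exists_discSol_eq_of_mem_span {d n m : ℕ} {P : Set (Fin d → ℝ)}
    {A : (Fin d → ℝ) → Matrix (Fin n) (Fin n) ℝ}
    {B : (Fin d → ℝ) → Matrix (Fin n) (Fin m) ℝ} {f : C(P, Fin n → ℝ)}
    (hf : f ∈ Submodule.span ℝ
        {f : C(P, Fin n → ℝ) | ∃ (k : ℕ) (j : Fin m),
          ∀ θ : P, f θ = (A θ ^ k) *ᵥ fun i => B θ i j}) :
    ∃ (T : ℕ) (u : ℕ → Fin m → ℝ), ∀ θ : P, discSol A B T u θ = f θ := by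
  obtain ⟨v, T, hv⟩ := exists_eq_sum_of_mem_span hf
  refine ⟨T, fun t => v (T - 1 - t), fun θ => ?_⟩
  rw [hv T le_rfl, discSol]
  refine Finset.sum_congr rfl fun k hk => ?_
  have hk' := Finset.mem_range.1 hk
  rw [show T - 1 - (T - 1 - k) = k by omega]

/-- The discrete-time ensemble `(A(θ), B(θ))` is uniformly ensemble controllable if and
only if the linear span of the set of continuous functions
`{ θ ↦ A(θ)^k b_j(θ) : k ∈ ℕ, j = 1, …, m }` is dense in `C(P, ℝⁿ)` (whose
compact-open topology is the sup-norm topology, as `P` is compact). -/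
theorem discUEC_iff_dense_span {d n m : ℕ} (P : Set (Fin d → ℝ))
    (hPne : P.Nonempty) (hPc : IsCompact P)
    (A : (Fin d → ℝ) → Matrix (Fin n) (Fin n) ℝ)
    (B : (Fin d → ℝ) → Matrix (Fin n) (Fin m) ℝ)
    (hA : ContinuousOn A P) (hB : ContinuousOn B P) :
    discUEC P A B ↔
      Dense ((Submodule.span ℝ
        {f : C(P, Fin n → ℝ) | ∃ (k : ℕ) (j : Fin m),
          ∀ θ : P, f θ = (A θ ^ k) *ᵥ fun i => B θ i j} :
            Submodule ℝ C(P, Fin n → ℝ)) : Set C(P, Fin n → ℝ)) := by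
  have : CompactSpace P := isCompact_iff_compactSpace.1 hPc
  have : Nonempty P := hPne.to_subtype
  rw [Metric.dense_iff]
  constructor
  · intro h g ε hε
    classical
    let xs : (Fin d → ℝ) → Fin n → ℝ := fun θ => if hθ : θ ∈ P then g ⟨θ, hθ⟩ else 0
    have hxs : ∀ θ : P, xs θ = g θ := fun θ => dif_pos θ.2
    have hcont : ContinuousOn xs P := by
      rw [continuousOn_iff_continuous_domRestrict]
      exact g.continuous.congr fun θ => (hxs θ).symm
    obtain ⟨T, u, hu⟩ := h xs hcont ε hε
    obtain ⟨f, hf, hfu⟩ := exists_mem_span_eq_discSol hA hB T u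
    refine ⟨f, ?_, hf⟩
    rw [Metric.mem_ball, ContinuousMap.dist_lt_iff_of_nonempty]
    intro θ
    rw [dist_eq_norm, hfu, ← hxs]
    exact hu θ θ.2
  · intro h xs hxs ε hε
    obtain ⟨f, hfg, hf⟩ := h ⟨P.domRestrict xs, hxs.domRestrict⟩ ε hε
    obtain ⟨T, u, hu⟩ := exists_discSol_eq_of_mem_span hf
    refine ⟨T, u, fun θ hθ => ?_⟩
    rw [Metric.mem_ball, ContinuousMap.dist_lt_iff_of_nonempty] at hfg
    rw [hu ⟨θ, hθ⟩, ← dist_eq_norm]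
    exact hfg ⟨θ, hθ⟩
end
end

section
/- Let P ⊂ ℝ^d be a nonempty compact set with closure(interior(P)) = P, and let Π : ℝ^d → ℝ^{n×n} × ℝ^{n×m}, θ ↦ (A(θ), B(θ)), be real analytic. Then the Hermite indices of the family (A(θ), B(θ)) are generically constant on P: there exists a tuple K* = (K*_1, …, K*_m) ∈ ℕ_0^m and a subset U ⊆ P that is open in P and dense in P such that for every θ ∈ U the Hermite indices of (A(θ), B(θ)) equal K*. -/
open Matrix

noncomputable section

/-- Strict ordering of the columns of the permuted Kalman matrix
`(b_1, Ab_1, …, A^{n-1}b_1, b_2, …, A^{n-1}b_m)`. -/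
def hermiteLex {n m : ℕ} (p q : Fin m × Fin n) : Prop :=
  p.1 < q.1 ∨ (p.1 = q.1 ∧ p.2 < q.2)

/-- The column `A^k b_j` of the permuted Kalman matrix is selected in the greedy
scan iff it is not a linear combination of the previous columns. -/
def hermiteSelected {n m : ℕ} (A : Matrix (Fin n) (Fin n) ℝ)
    (B : Matrix (Fin n) (Fin m) ℝ) (j : Fin m) (k : Fin n) : Prop :=
  (A ^ (k : ℕ)) *ᵥ (fun i => B i j) ∉
    Submodule.span ℝ
      ((fun p : Fin m × Fin n => (A ^ (p.2 : ℕ)) *ᵥ (fun i => B i p.1)) ''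
        {p | hermiteLex p (j, k)})

/-- The `i`-th Hermite index: the number of selected columns of the form `A^k b_i`. -/
def hermiteIndex {n m : ℕ} (A : Matrix (Fin n) (Fin n) ℝ)
    (B : Matrix (Fin n) (Fin m) ℝ) (i : Fin m) : ℕ :=
  Nat.card {k : Fin n // hermiteSelected A B i k}

/-- The set where an analytic function on `Fin d → ℝ`, not identically zero, does not vanish
is dense. -/
theorem dense_setOf_ne_zero_of_analyticOnNhd {d : ℕ} {g : (Fin d → ℝ) → ℝ}
    (hg : AnalyticOnNhd ℝ g Set.univ) {x₀ : Fin d → ℝ} (hx₀ : g x₀ ≠ 0) :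
    Dense {x | g x ≠ 0} := by
  intro x
  by_contra hx
  rw [mem_closure_iff_frequently, Filter.not_frequently] at hx
  have hx' : g =ᶠ[nhds x] 0 := hx.mono fun y hy => by simpa using hy
  exact hx₀ (congrFun (hg.eq_of_eventuallyEq (fun y _ => analyticAt_const) hx') x₀)

theorem analyticOnNhd_det {E ι : Type*} [NormedAddCommGroup E] [NormedSpace ℝ E]
    [Fintype ι] [DecidableEq ι] {M : E → Matrix ι ι ℝ} {s : Set E}
    (hM : ∀ i j, AnalyticOnNhd ℝ (fun x => M x i j) s) :
    AnalyticOnNhd ℝ (fun x => (M x).det) s := by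
  simp only [det_apply']
  exact Finset.analyticOnNhd_fun_sum _ fun σ _ => analyticOnNhd_const.mul
    (Finset.analyticOnNhd_fun_prod _ fun i _ => hM _ _)

theorem analyticOnNhd_pow_mulVec {E : Type*} [NormedAddCommGroup E] [NormedSpace ℝ E]
    {n : ℕ} {A : E → Matrix (Fin n) (Fin n) ℝ} {b : E → Fin n → ℝ} {s : Set E}
    (hA : ∀ i j, AnalyticOnNhd ℝ (fun x => A x i j) s)
    (hb : ∀ i, AnalyticOnNhd ℝ (fun x => b x i) s) (k : ℕ) (i : Fin n) :
    AnalyticOnNhd ℝ (fun x => (A x ^ k *ᵥ b x) i) s := by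
  induction k generalizing i with
  | zero => simpa using hb i
  | succ k ih =>
    have h (x) : (A x ^ (k + 1) *ᵥ b x) i = ∑ j, A x i j * (A x ^ k *ᵥ b x) j := by
      rw [pow_succ', ← mulVec_mulVec]
      rfl
    simp only [h]
    exact Finset.analyticOnNhd_fun_sum _ fun j _ => (hA i j).mul (ih j)

/-- Real vectors are linearly independent iff their Gram determinant does not vanish. -/
theorem linearIndependent_iff_det_mul_transpose_ne_zero {ι κ : Type*} [Fintype ι] [DecidableEq ι]
    [Fintype κ] (v : ι → κ → ℝ) :
    LinearIndependent ℝ v ↔ (Matrix.of v * (Matrix.of v)ᵀ).det ≠ 0 := by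
  rw [← isUnit_iff_ne_zero, ← Matrix.isUnit_iff_isUnit_det, ← Matrix.mulVec_injective_iff_isUnit]
  have h := Matrix.ker_mulVecLin_transpose_mul_self (Matrix.of v)ᵀ
  rw [Matrix.transpose_transpose] at h
  rw [← Matrix.coe_mulVecLin, ← LinearMap.ker_eq_bot, h, LinearMap.ker_eq_bot,
    Matrix.coe_mulVecLin, Matrix.mulVec_injective_iff]
  rfl

/-- Linear independence of an analytic family of vectors is an open condition, and a generic one
as soon as it holds at one point. -/
theorem isOpen_and_dense_setOf_linearIndependent {d : ℕ} {ι κ : Type*} [Finite ι] [Fintype κ]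
    {v : (Fin d → ℝ) → ι → κ → ℝ}
    (hv : ∀ i k, AnalyticOnNhd ℝ (fun x => v x i k) Set.univ)
    (hne : ∃ x, LinearIndependent ℝ (v x)) :
    IsOpen {x | LinearIndependent ℝ (v x)} ∧ Dense {x | LinearIndependent ℝ (v x)} := by
  classical
  have := Fintype.ofFinite ι
  simp only [linearIndependent_iff_det_mul_transpose_ne_zero] at hne ⊢
  obtain ⟨x₀, hx₀⟩ := hne
  have hg : AnalyticOnNhd ℝ (fun x => (Matrix.of (v x) * (Matrix.of (v x))ᵀ).det) Set.univ := by
    refine analyticOnNhd_det fun i j => ?_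
    simp only [Matrix.mul_apply, Matrix.of_apply, Matrix.transpose_apply]
    exact Finset.analyticOnNhd_fun_sum _ fun k _ => (hv i k).mul (hv j k)
  exact ⟨isOpen_ne_fun (continuousOn_univ.mp hg.continuousOn) continuous_const,
    dense_setOf_ne_zero_of_analyticOnNhd hg hx₀⟩

/-- Membership in a span is determined by which subfamilies are linearly independent. -/
theorem notMem_span_image_iff {ι V : Type*} [AddCommGroup V] [Module ℝ V] (v : ι → V)
    {s : Set ι} {c : ι} (hc : c ∉ s) :
    v c ∉ Submodule.span ℝ (v '' s) ↔
      ∀ t ⊆ s, LinearIndepOn ℝ v t → LinearIndepOn ℝ v (insert c t) := by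
  refine ⟨fun h t hts ht => (linearIndepOn_insert fun hct => hc (hts hct)).2
    ⟨ht, fun hmem => h (Submodule.span_mono (Set.image_mono hts) hmem)⟩, fun h hmem => ?_⟩
  obtain ⟨t, hts, -, hspan, ht⟩ :=
    exists_linearIndepOn_extension (linearIndepOn_empty ℝ v) (Set.empty_subset s)
  refine ((linearIndepOn_insert fun hct => hc (hts hct)).1 (h t hts ht)).2 ?_
  exact Submodule.span_le.2 hspan hmem

/-- The column `A^k b_j` of the Kalman matrix, indexed by the pair `(j, k)`. -/
def kalmanColumn {n m : ℕ} (A : Matrix (Fin n) (Fin n) ℝ) (B : Matrix (Fin n) (Fin m) ℝ)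
    (p : Fin m × Fin n) : Fin n → ℝ :=
  (A ^ (p.2 : ℕ)) *ᵥ (fun i => B i p.1)

/-- Hermite indices depend only on which sets of Kalman columns are linearly independent. -/
theorem hermiteIndex_eq_of_linearIndepOn_iff {n m : ℕ} {A A' : Matrix (Fin n) (Fin n) ℝ}
    {B B' : Matrix (Fin n) (Fin m) ℝ}
    (h : ∀ t : Set (Fin m × Fin n), LinearIndepOn ℝ (kalmanColumn A B) t ↔
      LinearIndepOn ℝ (kalmanColumn A' B') t) (i : Fin m) :
    hermiteIndex A B i = hermiteIndex A' B' i := by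
  have hsel (k : Fin n) : hermiteSelected A B i k ↔ hermiteSelected A' B' i k := by
    have hc : (i, k) ∉ {p : Fin m × Fin n | hermiteLex p (i, k)} := by simp [hermiteLex]
    refine (notMem_span_image_iff (kalmanColumn A B) hc).trans
      (Iff.trans ?_ (notMem_span_image_iff (kalmanColumn A' B') hc).symm)
    simp only [h]
  simp only [hermiteIndex, hsel]

/-- For a real analytic family `θ ↦ (A(θ), B(θ))` and a compact set `P ⊂ ℝ^d` with
`closure (interior P) = P`, the Hermite indices are generically constant on `P`:
they equal a fixed tuple `K*` on a subset of `P` that is open in `P` and dense in `P`. -/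
theorem hermiteIndices_generically_constant {d n m : ℕ}
    (P : Set (Fin d → ℝ)) (hPne : P.Nonempty) (hPc : IsCompact P)
    (hPreg : closure (interior P) = P)
    (A : (Fin d → ℝ) → Matrix (Fin n) (Fin n) ℝ)
    (B : (Fin d → ℝ) → Matrix (Fin n) (Fin m) ℝ)
    (hA : ∀ i j, AnalyticOn ℝ (fun θ => A θ i j) Set.univ)
    (hB : ∀ i j, AnalyticOn ℝ (fun θ => B θ i j) Set.univ) :
    ∃ (Kstar : Fin m → ℕ) (U : Set (Fin d → ℝ)), U ⊆ P ∧
      (∃ V : Set (Fin d → ℝ), IsOpen V ∧ U = V ∩ P) ∧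
      P ⊆ closure U ∧
      ∀ θ ∈ U, ∀ i : Fin m, hermiteIndex (A θ) (B θ) i = Kstar i := by
  have hA' (i j) : AnalyticOnNhd ℝ (fun θ => A θ i j) Set.univ :=
    isOpen_univ.analyticOn_iff_analyticOnNhd.1 (hA i j)
  have hB' (i j) : AnalyticOnNhd ℝ (fun θ => B θ i j) Set.univ :=
    isOpen_univ.analyticOn_iff_analyticOnNhd.1 (hB i j)
  let L (t : Set (Fin m × Fin n)) : Set (Fin d → ℝ) :=
    {θ | LinearIndepOn ℝ (kalmanColumn (A θ) (B θ)) t}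
  let D : Set (Fin d → ℝ) := ⋂ t ∈ {t | (L t).Nonempty}, L t
  have hL (t) (ht : (L t).Nonempty) : IsOpen (L t) ∧ Dense (L t) :=
    isOpen_and_dense_setOf_linearIndependent
      (fun p i => analyticOnNhd_pow_mulVec hA' (fun i => hB' i p.1.1) _ i) ht
  have hDo : IsOpen D := (Set.toFinite _).isOpen_biInter fun t ht => (hL t ht).1
  have hDd : Dense D := dense_biInter_of_isOpen (fun t ht => (hL t ht).1)
    (Set.to_countable _) fun t ht => (hL t ht).2
  have hD {θ θ'} (hθ' : θ' ∈ D) (t) (ht : θ ∈ L t) : θ' ∈ L t :=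
    Set.mem_iInter₂.1 hθ' t ⟨θ, ht⟩
  obtain ⟨θ₀, hθ₀⟩ := hDd.nonempty
  refine ⟨hermiteIndex (A θ₀) (B θ₀), D ∩ P, Set.inter_subset_right, ⟨D, hDo, rfl⟩, ?_,
    fun θ hθ => hermiteIndex_eq_of_linearIndepOn_iff fun t => ⟨hD hθ₀ t, hD hθ.1 t⟩⟩
  calc P = closure (interior P) := hPreg.symm
    _ ⊆ closure (interior P ∩ D) :=
      closure_minimal (hDd.open_subset_closure_inter isOpen_interior) isClosed_closure
    _ ⊆ closure (D ∩ P) := closure_mono fun θ hθ => ⟨hθ.2, interior_subset hθ.1⟩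
end
end
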